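/- Let S be a compact metric space and θ a Borel probability measure on S. For all x, x′ ∈ S, the total variation distance between the two-step kernels (K^{θ,1,2})²(x,·) and (K^{θ,1,2})²(x′,·) is at most 1/2, where (K^{θ,1,2})²(x,B) = ∫_S K^{θ,1,2}(y,B) K^{θ,1,2}(x,dy). -/

import Mathlib

open MeasureTheory
open scoped ENNReal

/-- The transition kernel `K^{θ,1,2}(x,A)`: step to the nearer of two i.i.d. `θ`-samples,
ties broken uniformly. -/
noncomputable def K12 {S : Type*} [MetricSpace S] [MeasurableSpace S]
    (θ : Measure S) (x : S) (A : Set S) : ℝ≥0∞ :=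
  ∫⁻ y in A, (2 * θ {z | dist x y < dist x z} + θ {z | dist x z = dist x y}) ∂θ

/-- The kernel `K^{θ,1,2}(x,·)` as a measure (density with respect to `θ`). -/
noncomputable def K12m {S : Type*} [MetricSpace S] [MeasurableSpace S]
    (θ : Measure S) (x : S) : Measure S :=
  θ.withDensity (fun y => 2 * θ {z | dist x y < dist x z} + θ {z | dist x z = dist x y})

/-- The two-step kernel `(K^{θ,1,2})²(x,B) = ∫ K^{θ,1,2}(y,B) K^{θ,1,2}(x,dy)`. -/
noncomputable def K12sq {S : Type*} [MetricSpace S] [MeasurableSpace S]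
    (θ : Measure S) (x : S) (B : Set S) : ℝ≥0∞ :=
  ∫⁻ y, K12 θ y B ∂(K12m θ x)

/-- For a finite measure, the chance that the first of two independent samples has the smaller
`r`-value, with ties broken uniformly, is one half. -/
theorem lintegral_two_mul_measure_lt_add_measure_eq {α : Type*} [MeasurableSpace α]
    (ν : Measure α) [IsFiniteMeasure ν] {r : α → ℝ} (hr : Measurable r) :
    ∫⁻ y, (2 * ν {z | r y < r z} + ν {z | r z = r y}) ∂ν = ν Set.univ ^ 2 := by
  have hlt : MeasurableSet {p : α × α | r p.1 < r p.2} :=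
    measurableSet_lt (hr.comp measurable_fst) (hr.comp measurable_snd)
  have hm : Measurable fun y => ν {z | r y < r z} := measurable_measure_prodMk_left hlt
  have hm' : Measurable fun y => ν {z | r z < r y} := measurable_measure_prodMk_right hlt
  have hswap : ∫⁻ y, ν {z | r y < r z} ∂ν = ∫⁻ y, ν {z | r z < r y} ∂ν :=
    (Measure.prod_apply hlt).symm.trans (Measure.prod_apply_symm hlt)
  have hsplit (y : α) :
      ν {z | r y < r z} + (ν {z | r z < r y} + ν {z | r z = r y}) = ν Set.univ := by
    have hmlt : MeasurableSet {z | r z < r y} := measurableSet_lt hr measurable_const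
    have hmeq : MeasurableSet {z | r z = r y} := measurableSet_eq_fun hr measurable_const
    rw [← measure_union _ hmeq, ← measure_union _ (hmlt.union hmeq)]
    · congr 1
      ext z
      simpa using lt_trichotomy (r y) (r z) |>.imp_right (Or.symm ∘ Or.imp_left Eq.symm)
    · rw [Set.disjoint_left]
      rintro z (hz : r y < r z) ((h : r z < r y) | (h : r z = r y)) <;> linarith
    · rw [Set.disjoint_left]
      rintro z (hz : r z < r y) (h : r z = r y)
      linarith
  calc ∫⁻ y, (2 * ν {z | r y < r z} + ν {z | r z = r y}) ∂ν
      = ∫⁻ y, (ν {z | r y < r z} + (ν {z | r y < r z} + ν {z | r z = r y})) ∂ν := by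
        simp_rw [two_mul, add_assoc]
    _ = ∫⁻ y, (ν {z | r y < r z} + (ν {z | r z < r y} + ν {z | r z = r y})) ∂ν := by
        rw [lintegral_add_left hm, lintegral_add_left hm, lintegral_add_left hm,
          lintegral_add_left hm', hswap]
    _ = ν Set.univ ^ 2 := by
        simp_rw [hsplit, lintegral_const, sq]

theorem K12_univ {S : Type*} [MetricSpace S] [MeasurableSpace S] [BorelSpace S]
    (θ : Measure S) [IsProbabilityMeasure θ] (x : S) : K12 θ x Set.univ = 1 := by
  have hr : Measurable (dist x) := (continuous_const.dist continuous_id).measurable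
  simpa [K12] using lintegral_two_mul_measure_lt_add_measure_eq θ hr

theorem sq_measure_le_K12 {S : Type*} [MetricSpace S] [MeasurableSpace S] [BorelSpace S]
    (θ : Measure S) [IsFiniteMeasure θ] (x : S) (B : Set S) : θ B ^ 2 ≤ K12 θ x B := by
  have hr : Measurable (dist x) := (continuous_const.dist continuous_id).measurable
  have h := lintegral_two_mul_measure_lt_add_measure_eq (θ.restrict B) hr
  rw [Measure.restrict_apply_univ] at h
  rw [← h]
  refine lintegral_mono fun y => ?_
  dsimp only
  gcongr <;> exact Measure.restrict_le_self

theorem K12_add_K12_compl {S : Type*} [MetricSpace S] [MeasurableSpace S] [BorelSpace S]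
    (θ : Measure S) [IsProbabilityMeasure θ] (x : S) {B : Set S} (hB : MeasurableSet B) :
    K12 θ x B + K12 θ x Bᶜ = 1 := by
  rw [← K12_univ θ x, K12, K12, K12, lintegral_add_compl _ hB, Measure.restrict_univ]

theorem K12_le_one_sub {S : Type*} [MetricSpace S] [MeasurableSpace S] [BorelSpace S]
    (θ : Measure S) [IsProbabilityMeasure θ] (x : S) {B : Set S} (hB : MeasurableSet B) :
    K12 θ x B ≤ 1 - θ Bᶜ ^ 2 := by
  refine ENNReal.le_sub_of_add_le_right (by finiteness) ?_
  rw [← K12_add_K12_compl θ x hB]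
  gcongr
  exact sq_measure_le_K12 θ x Bᶜ

theorem isProbabilityMeasure_K12m {S : Type*} [MetricSpace S] [MeasurableSpace S] [BorelSpace S]
    (θ : Measure S) [IsProbabilityMeasure θ] (x : S) : IsProbabilityMeasure (K12m θ x) :=
  ⟨by rw [K12m, withDensity_apply _ MeasurableSet.univ]; exact K12_univ θ x⟩

theorem K12sq_toReal_mem_Icc {S : Type*} [MetricSpace S] [MeasurableSpace S] [BorelSpace S]
    (θ : Measure S) [IsProbabilityMeasure θ] (x : S) {B : Set S} (hB : MeasurableSet B) :
    (K12sq θ x B).toReal ∈ Set.Icc (θ.real B ^ 2) (1 - (1 - θ.real B) ^ 2) := by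
  have := isProbabilityMeasure_K12m θ x
  have hlow : θ B ^ 2 ≤ K12sq θ x B := by
    simpa [K12sq] using lintegral_mono (μ := K12m θ x) fun y => sq_measure_le_K12 θ y B
  have hup : K12sq θ x B ≤ 1 - θ Bᶜ ^ 2 := by
    simpa [K12sq] using lintegral_mono (μ := K12m θ x) fun y => K12_le_one_sub θ y hB
  have hle : θ Bᶜ ^ 2 ≤ 1 := pow_le_one' prob_le_one 2
  constructor
  · simpa [Measure.real] using ENNReal.toReal_mono (ne_top_of_le_ne_top (by finiteness) hup) hlow
  · have h := ENNReal.toReal_mono (by finiteness) hup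
    rw [ENNReal.toReal_sub_of_le hle (by finiteness), ENNReal.toReal_pow] at h
    rwa [← probReal_compl_eq_one_sub hB]

theorem stmt_2 {S : Type*} [MetricSpace S] [CompactSpace S] [MeasurableSpace S] [BorelSpace S]
    (θ : Measure S) [IsProbabilityMeasure θ] (x x' : S) :
    ∀ B : Set S, MeasurableSet B →
      |(K12sq θ x B).toReal - (K12sq θ x' B).toReal| ≤ 1 / 2 := by
  intro B hB
  obtain ⟨h₁, h₂⟩ := K12sq_toReal_mem_Icc θ x hB
  obtain ⟨h₃, h₄⟩ := K12sq_toReal_mem_Icc θ x' hB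
  rw [abs_le]
  constructor <;> nlinarith [sq_nonneg (2 * θ.real B - 1)]
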